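/- Sufficient separability criterion 1: Let N ≥ 1, let σ be a Hermitian matrix on ℂ² ⊗ ℂ^N, and let α be real with -1 ≤ α ≤ 2 and α ≠ 0. If the matrix (1/α)·(σ - (Tr(σ)/(2N+α))·𝟙_{2N}) is positive semidefinite, then σ is separable. -/

import Mathlib

open Matrix Kronecker
open scoped ComplexOrder

noncomputable section

/-- A Hermitian matrix on ℂ^M ⊗ ℂ^N is separable if it is a finite sum of Kronecker
products of positive semidefinite matrices. -/
def IsSeparableMat {M N : ℕ} (σ : Matrix (Fin M × Fin N) (Fin M × Fin N) ℂ) : Prop :=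
  ∃ (k : ℕ) (A : Fin k → Matrix (Fin M) (Fin M) ℂ) (B : Fin k → Matrix (Fin N) (Fin N) ℂ),
    (∀ i, (A i).PosSemidef) ∧ (∀ i, (B i).PosSemidef) ∧ σ = ∑ i, A i ⊗ₖ B i

/-- Partial transpose on the first (Alice) factor. -/
def ptA {M N : ℕ} (ρ : Matrix (Fin M × Fin N) (Fin M × Fin N) ℂ) :
    Matrix (Fin M × Fin N) (Fin M × Fin N) ℂ :=
  fun p q => ρ (q.1, p.2) (p.1, q.2)

/-- Partial transpose on the second (Bob) factor. -/
def ptB {M N : ℕ} (ρ : Matrix (Fin M × Fin N) (Fin M × Fin N) ℂ) :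
    Matrix (Fin M × Fin N) (Fin M × Fin N) ℂ :=
  fun p q => ρ (p.1, q.2) (q.1, p.2)

/-- The second Pauli matrix σ₂. -/
def pauli2 : Matrix (Fin 2) (Fin 2) ℂ := !![0, -Complex.I; Complex.I, 0]

/-- ρ̃_A = (σ₂ ⊗ 𝟙_N) ρ^{T_A} (σ₂ ⊗ 𝟙_N). -/
def tildeA {N : ℕ} (ρ : Matrix (Fin 2 × Fin N) (Fin 2 × Fin N) ℂ) :
    Matrix (Fin 2 × Fin N) (Fin 2 × Fin N) ℂ :=
  (pauli2 ⊗ₖ (1 : Matrix (Fin N) (Fin N) ℂ)) * ptA ρ *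
    (pauli2 ⊗ₖ (1 : Matrix (Fin N) (Fin N) ℂ))

end

/-! ### Closure properties of separable matrices -/

namespace IsSeparableMat

variable {M N : ℕ}

theorem zero : IsSeparableMat (0 : Matrix (Fin M × Fin N) (Fin M × Fin N) ℂ) :=
  ⟨0, Fin.elim0, Fin.elim0, fun i => i.elim0, fun i => i.elim0, by simp⟩

theorem kronecker {A : Matrix (Fin M) (Fin M) ℂ} {B : Matrix (Fin N) (Fin N) ℂ}
    (hA : A.PosSemidef) (hB : B.PosSemidef) : IsSeparableMat (A ⊗ₖ B) :=
  ⟨1, fun _ => A, fun _ => B, fun _ => hA, fun _ => hB, by simp⟩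

theorem add {σ τ : Matrix (Fin M × Fin N) (Fin M × Fin N) ℂ}
    (hσ : IsSeparableMat σ) (hτ : IsSeparableMat τ) : IsSeparableMat (σ + τ) := by
  obtain ⟨k, A, B, hA, hB, rfl⟩ := hσ
  obtain ⟨l, C, D, hC, hD, rfl⟩ := hτ
  refine ⟨k + l, Fin.append A C, Fin.append B D, fun i => ?_, fun i => ?_, ?_⟩
  · refine Fin.addCases (fun j => ?_) (fun j => ?_) i
    · simpa using hA j
    · simpa using hC j
  · refine Fin.addCases (fun j => ?_) (fun j => ?_) i
    · simpa using hB j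
    · simpa using hD j
  · simp [Fin.sum_univ_add]

theorem sum {ι : Type*} (s : Finset ι) {σ : ι → Matrix (Fin M × Fin N) (Fin M × Fin N) ℂ}
    (hσ : ∀ i ∈ s, IsSeparableMat (σ i)) : IsSeparableMat (∑ i ∈ s, σ i) :=
  Finset.sum_induction _ IsSeparableMat (fun _ _ => add) zero hσ

theorem conj_kronecker_one {σ : Matrix (Fin M × Fin N) (Fin M × Fin N) ℂ}
    (hσ : IsSeparableMat σ) (V : Matrix (Fin M) (Fin M) ℂ) :
    IsSeparableMat ((V ⊗ₖ (1 : Matrix (Fin N) (Fin N) ℂ)) * σ *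
      (V ⊗ₖ (1 : Matrix (Fin N) (Fin N) ℂ))ᴴ) := by
  obtain ⟨k, A, B, hA, hB, rfl⟩ := hσ
  refine ⟨k, fun i => V * A i * Vᴴ, B, fun i => (hA i).mul_mul_conjTranspose_same V, hB, ?_⟩
  simp [Matrix.mul_sum, Matrix.sum_mul, conjTranspose_kronecker, ← mul_kronecker_mul]

end IsSeparableMat

/-! ### Positivity of the identity minus rank-one terms -/

/-- Bessel's inequality, in matrix form, for two orthogonal vectors (possibly zero). -/
theorem posSemidef_one_sub_vecMulVec_sub_vecMulVec {n : Type*} [Fintype n] [DecidableEq n]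
    {u v : n → ℂ} {x y : ℝ} (hx : star u ⬝ᵥ u = x) (hy : star v ⬝ᵥ v = y)
    (huv : star u ⬝ᵥ v = 0) :
    (1 - (x : ℂ)⁻¹ • vecMulVec u (star u) - (y : ℂ)⁻¹ • vecMulVec v (star v)).PosSemidef := by
  have hvu : star v ⬝ᵥ u = 0 := by
    rw [← star_star (star v ⬝ᵥ u), star_dotProduct, star_star, dotProduct_comm]
    simpa [dotProduct_comm] using huv
  set P := (x : ℂ)⁻¹ • vecMulVec u (star u) with hP
  set Q := (y : ℂ)⁻¹ • vecMulVec v (star v) with hQ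
  have hPP : P * P = P := by
    simp only [hP, smul_mul_smul_comm, vecMulVec_mul_vecMulVec, hx, vecMulVec_smul, smul_smul]
    rcases eq_or_ne x 0 with rfl | h
    · simp
    · congr 1
      have : (x : ℂ) ≠ 0 := by exact_mod_cast h
      field_simp
  have hQQ : Q * Q = Q := by
    simp only [hQ, smul_mul_smul_comm, vecMulVec_mul_vecMulVec, hy, vecMulVec_smul, smul_smul]
    rcases eq_or_ne y 0 with rfl | h
    · simp
    · congr 1
      have : (y : ℂ) ≠ 0 := by exact_mod_cast h
      field_simp
  have hPQ : P * Q = 0 := by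
    simp [hP, hQ, vecMulVec_mul_vecMulVec, huv]
  have hQP : Q * P = 0 := by
    simp [hP, hQ, vecMulVec_mul_vecMulVec, hvu]
  have hPH : Pᴴ = P := by simp [hP, conjTranspose_vecMulVec]
  have hQH : Qᴴ = Q := by simp [hQ, conjTranspose_vecMulVec]
  have h := posSemidef_conjTranspose_mul_self (1 - P - Q)
  have e : (1 - P - Q)ᴴ * (1 - P - Q) = 1 - P - Q := by
    simp only [conjTranspose_sub, conjTranspose_one, hPH, hQH]
    simp only [sub_mul, mul_sub, one_mul, mul_one, hPP, hQQ, hPQ, hQP]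
    abel
  rwa [e] at h

theorem posSemidef_smul_one_sub_vecMulVec_sub_vecMulVec {n : Type*} [Fintype n] [DecidableEq n]
    {u v : n → ℂ} {x y a b S : ℝ} (hx : star u ⬝ᵥ u = x) (hy : star v ⬝ᵥ v = y)
    (huv : star u ⬝ᵥ v = 0) (hS : 0 ≤ S) (ha : a * x ≤ S) (hb : b * y ≤ S) :
    ((S : ℂ) • 1 - (a : ℂ) • vecMulVec u (star u) - (b : ℂ) • vecMulVec v (star v)).PosSemidef := by
  have key : ∀ {w : n → ℂ} {z c : ℝ}, star w ⬝ᵥ w = z → c * z ≤ S →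
      (((S / z - c : ℝ) : ℂ) • vecMulVec w (star w)).PosSemidef := by
    intro w z c hz hc
    rcases eq_or_ne w 0 with rfl | hw
    · simpa using PosSemidef.zero
    · refine (posSemidef_vecMulVec_self_star w).smul ?_
      have h0 : (0 : ℂ) < z := hz ▸ dotProduct_star_self_pos_iff.2 hw
      have h0 : 0 < z := by exact_mod_cast h0
      have : c ≤ S / z := by rwa [le_div_iff₀ h0]
      exact_mod_cast sub_nonneg.2 this
  have h := (((posSemidef_one_sub_vecMulVec_sub_vecMulVec hx hy huv).smul
    (show (0 : ℂ) ≤ S by exact_mod_cast hS)).add (key hx ha)).add (key hy hb)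
  convert h using 1
  push_cast
  simp only [smul_sub, sub_smul, smul_smul, div_eq_mul_inv]
  abel

/-! ### Pure states -/

/-- Averaging over the fourth roots of unity `z` the products built from `p u + z q v`
produces the off-diagonal blocks of a rank-one matrix. -/
theorem isSeparableMat_of_mul_eq {N : ℕ} {u v : Fin N → ℂ} {α S p q : ℝ}
    (hpq : p * q = α ∨ u = 0 ∨ v = 0)
    (h0 : ((S : ℂ) • 1 - ((p ^ 2 - α : ℝ) : ℂ) • vecMulVec u (star u)
      - ((q ^ 2 : ℝ) : ℂ) • vecMulVec v (star v)).PosSemidef)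
    (h1 : ((S : ℂ) • 1 - ((p ^ 2 : ℝ) : ℂ) • vecMulVec u (star u)
      - ((q ^ 2 - α : ℝ) : ℂ) • vecMulVec v (star v)).PosSemidef) :
    IsSeparableMat ((α : ℂ) • vecMulVec (fun i : Fin 2 × Fin N => ![u, v] i.1 i.2)
      (star fun i : Fin 2 × Fin N => ![u, v] i.1 i.2) + (S : ℂ) • 1) := by
  let z : Fin 4 → ℂ := ![1, Complex.I, -1, -Complex.I]
  let a : Fin 4 → Fin 2 → ℂ := fun k => ![1 / 2, star (z k) / 2]
  let w : Fin 4 → Fin N → ℂ := fun k => (p : ℂ) • u + (z k * q) • v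
  let e : Fin 2 → Fin 2 → ℂ := fun i => Pi.single i 1
  have hsep := ((IsSeparableMat.sum Finset.univ fun k _ => IsSeparableMat.kronecker
    (posSemidef_vecMulVec_self_star (a k)) (posSemidef_vecMulVec_self_star (w k))).add
    (.kronecker (posSemidef_vecMulVec_self_star (e 0)) h0)).add
    (.kronecker (posSemidef_vecMulVec_self_star (e 1)) h1)
  convert hsep using 1
  have huv : ∀ n m, (α : ℂ) * (u n * starRingEnd ℂ (v m)) = p * q * (u n * starRingEnd ℂ (v m)) := by
    rcases hpq with rfl | rfl | rfl <;> simp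
  have hvu : ∀ n m, (α : ℂ) * (v n * starRingEnd ℂ (u m)) = p * q * (v n * starRingEnd ℂ (u m)) := by
    rcases hpq with rfl | rfl | rfl <;> simp
  ext ⟨i, n⟩ ⟨j, m⟩
  have hI : Complex.I ^ 2 = -1 := Complex.I_sq
  simp only [Matrix.add_apply, kroneckerMap_apply, vecMulVec_apply,
    Pi.star_apply, Fin.sum_univ_four, Matrix.smul_apply, Matrix.sub_apply]
  fin_cases i <;> fin_cases j <;>
    simp [Matrix.one_apply, a, w, z, e]
  · ring_nf
    simp only [hI]
    ring
  · rw [huv n m]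
    ring_nf
    simp only [hI]
    ring
  · rw [hvu n m]
    ring_nf
    simp only [hI]
    ring
  · ring_nf
    simp only [hI, Complex.I_pow_four]
    ring

theorem isSeparableMat_of_orthogonal {N : ℕ} {u v : Fin N → ℂ} {x y α : ℝ}
    (hα1 : -1 ≤ α) (hα2 : α ≤ 2) (hx : star u ⬝ᵥ u = x) (hy : star v ⬝ᵥ v = y)
    (huv : star u ⬝ᵥ v = 0) :
    IsSeparableMat ((α : ℂ) • vecMulVec (fun i : Fin 2 × Fin N => ![u, v] i.1 i.2)
      (star fun i : Fin 2 × Fin N => ![u, v] i.1 i.2) + ((x + y : ℝ) : ℂ) • 1) := by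
  have hx0 : 0 ≤ x := by
    have : (0 : ℂ) ≤ x := hx ▸ dotProduct_star_self_nonneg u
    exact_mod_cast this
  have hy0 : 0 ≤ y := by
    have : (0 : ℂ) ≤ y := hy ▸ dotProduct_star_self_nonneg v
    exact_mod_cast this
  have main : ∀ p q : ℝ, (p * q = α ∨ u = 0 ∨ v = 0) → (p ^ 2 - α) * x ≤ x + y → q ^ 2 * y ≤ x + y →
      p ^ 2 * x ≤ x + y → (q ^ 2 - α) * y ≤ x + y →
      IsSeparableMat ((α : ℂ) • vecMulVec (fun i : Fin 2 × Fin N => ![u, v] i.1 i.2)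
        (star fun i : Fin 2 × Fin N => ![u, v] i.1 i.2) + ((x + y : ℝ) : ℂ) • 1) :=
    fun p q hpq h1 h2 h3 h4 => isSeparableMat_of_mul_eq hpq
      (posSemidef_smul_one_sub_vecMulVec_sub_vecMulVec hx hy huv (by positivity) h1 h2)
      (posSemidef_smul_one_sub_vecMulVec_sub_vecMulVec hx hy huv (by positivity) h3 h4)
  by_cases huv0 : u = 0 ∨ v = 0
  · refine main 0 0 (Or.inr huv0) ?_ ?_ ?_ ?_ <;> nlinarith
  obtain ⟨hu0, hv0⟩ := not_or.1 huv0
  have hx' : 0 < x := by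
    have : (0 : ℂ) < x := hx ▸ dotProduct_star_self_pos_iff.2 hu0
    exact_mod_cast this
  have hy' : 0 < y := by
    have : (0 : ℂ) < y := hy ▸ dotProduct_star_self_pos_iff.2 hv0
    exact_mod_cast this
  have weight : ∀ s : ℝ, 0 < s → s ≤ x + y → s ≤ x + y + α * x →
      α ^ 2 * (x * y) ≤ (x + y) * s → α ^ 2 * (x * y) ≤ (x + y + α * y) * s →
      IsSeparableMat ((α : ℂ) • vecMulVec (fun i : Fin 2 × Fin N => ![u, v] i.1 i.2)
        (star fun i : Fin 2 × Fin N => ![u, v] i.1 i.2) + ((x + y : ℝ) : ℂ) • 1) := by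
    intro s hs h1 h2 h3 h4
    have hp : 0 < √(s / x) := Real.sqrt_pos.2 (by positivity)
    have hp2 : √(s / x) ^ 2 = s / x := Real.sq_sqrt (by positivity)
    have hpx : s / x * x = s := div_mul_cancel₀ s hx'.ne'
    have hq : α ^ 2 / (s / x) * y = α ^ 2 * (x * y) / s := by field_simp
    refine main √(s / x) (α / √(s / x)) (Or.inl (mul_div_cancel₀ α hp.ne')) ?_ ?_ ?_ ?_
    · rw [hp2]; linarith
    · rw [div_pow, hp2, hq, div_le_iff₀ hs]; exact h3
    · rw [hp2]; linarith
    · rw [div_pow, hp2, sub_mul, hq, sub_le_iff_le_add, div_le_iff₀ hs]; exact h4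
  have hxy : 0 < x * y := mul_pos hx' hy'
  rcases le_or_gt 0 α with hα | hα
  · have h : α ^ 2 * (x * y) ≤ (x + y) * (x + y) := by
      have : α ^ 2 ≤ 4 := by nlinarith
      nlinarith [sq_nonneg (x - y)]
    have hαx : 0 ≤ α * x := by positivity
    have hαy : 0 ≤ α * y := by positivity
    exact weight (x + y) (by positivity) le_rfl (by linarith) h (by nlinarith)
  · have h : α ^ 2 * (x * y) ≤ (x + y + α * y) * (x + y + α * x) := by
      nlinarith [mul_nonneg (neg_le_iff_add_nonneg.1 hα1) (sq_nonneg (x + y))]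
    have hs : 0 < x + y + α * x := by nlinarith
    exact weight (x + y + α * x) hs (by nlinarith) le_rfl
      (h.trans (mul_le_mul_of_nonneg_right (by nlinarith) hs.le)) h

theorem isSeparableMat_vecMulVec {N : ℕ} (ψ : Fin 2 × Fin N → ℂ) {α : ℝ}
    (hα1 : -1 ≤ α) (hα2 : α ≤ 2) :
    IsSeparableMat ((α : ℂ) • vecMulVec ψ (star ψ) + (vecMulVec ψ (star ψ)).trace • 1) := by
  let Ψ : Matrix (Fin N) (Fin 2) ℂ := fun n a => ψ (a, n)
  have hG : (Ψᴴ * Ψ).IsHermitian := isHermitian_conjTranspose_mul_self Ψ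
  let U : Matrix (Fin 2) (Fin 2) ℂ := hG.eigenvectorUnitary
  have hUU : U * Uᴴ = 1 := Unitary.coe_mul_star_self _
  have hUU' : Uᴴ * U = 1 := Unitary.coe_star_mul_self _
  let Φ := Ψ * U
  have hΨ : Ψ = Φ * Uᴴ := by simp [Φ, Matrix.mul_assoc, hUU]
  have hΦ : Φᴴ * Φ = diagonal (RCLike.ofReal ∘ hG.eigenvalues) := by
    have := hG.conjStarAlgAut_star_eigenvectorUnitary
    rw [Unitary.conjStarAlgAut_star_apply] at this
    rw [← this]
    simp [Φ, U, Matrix.mul_assoc, star_eq_conjTranspose]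
  let V : Matrix (Fin 2) (Fin 2) ℂ := Uᴴᵀ
  have hVH : Vᴴ = Uᵀ := by
    ext
    simp [V]
  have hV : Vᴴ * V = 1 := by
    rw [hVH, ← transpose_mul, hUU', transpose_one]
  have hV' : V * Vᴴ = 1 := by
    rw [hVH, ← transpose_mul, hUU, transpose_one]
  let W := V ⊗ₖ (1 : Matrix (Fin N) (Fin N) ℂ)
  have hW : Wᴴ * W = 1 := by
    simp [W, conjTranspose_kronecker, ← mul_kronecker_mul, hV]
  have hW' : W * Wᴴ = 1 := by
    simp [W, conjTranspose_kronecker, ← mul_kronecker_mul, hV']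
  let φ : Fin 2 × Fin N → ℂ := fun i => ![fun n => Φ n 0, fun n => Φ n 1] i.1 i.2
  have hψ : ψ = W *ᵥ φ := by
    ext ⟨a, n⟩
    have := congrFun (congrFun hΨ n) a
    simp [W, φ, V, mulVec, dotProduct, Fintype.sum_prod_type, Matrix.one_apply, Ψ] at this ⊢
    rw [this]
    simp [Matrix.mul_apply]
    ring
  have hρ : vecMulVec ψ (star ψ) = W * vecMulVec φ (star φ) * Wᴴ := by
    rw [mul_vecMulVec, vecMulVec_mul, hψ, star_mulVec]
  have hdot : ∀ a b, (star fun n => Φ n a) ⬝ᵥ (fun n => Φ n b) = (Φᴴ * Φ) a b :=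
    fun _ _ => rfl
  have key := (isSeparableMat_of_orthogonal (u := fun n => Φ n 0) (v := fun n => Φ n 1)
    (x := hG.eigenvalues 0) (y := hG.eigenvalues 1) hα1 hα2
    (by rw [hdot, hΦ]; simp) (by rw [hdot, hΦ]; simp) (by rw [hdot, hΦ]; simp)).conj_kronecker_one V
  have htr : (vecMulVec ψ (star ψ)).trace = ((hG.eigenvalues 0 + hG.eigenvalues 1 : ℝ) : ℂ) := by
    have h1 : (Φᴴ * Φ).trace = ((hG.eigenvalues 0 + hG.eigenvalues 1 : ℝ) : ℂ) := by
      simp [hΦ]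
    rw [hρ, trace_mul_comm, ← Matrix.mul_assoc, hW, Matrix.one_mul, ← h1]
    simp [trace_vecMulVec, dotProduct, Fintype.sum_prod_type, φ, Matrix.trace_fin_two,
      Matrix.mul_apply, mul_comm]
  convert key using 1
  rw [Matrix.mul_add, Matrix.add_mul, htr, hρ]
  simp only [Matrix.mul_smul, Matrix.smul_mul, Matrix.mul_one]
  change _ = (α : ℂ) • (W * vecMulVec φ (star φ) * Wᴴ) + _ • (W * Wᴴ)
  rw [hW']

open scoped MatrixOrder in
theorem isSeparableMat_of_posSemidef {N : ℕ} {ρ : Matrix (Fin 2 × Fin N) (Fin 2 × Fin N) ℂ}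
    (hρ : ρ.PosSemidef) {α : ℝ} (hα1 : -1 ≤ α) (hα2 : α ≤ 2) :
    IsSeparableMat ((α : ℂ) • ρ + ρ.trace • 1) := by
  obtain ⟨B, rfl⟩ := CStarAlgebra.nonneg_iff_eq_star_mul_self.1 hρ.nonneg
  have hB : star B * B = ∑ k, vecMulVec (star (B k)) (star (star (B k))) := by
    ext i j
    simp [Matrix.mul_apply, Matrix.sum_apply, vecMulVec_apply]
  have h := IsSeparableMat.sum Finset.univ
    fun k _ => isSeparableMat_vecMulVec (star (B k)) hα1 hα2
  rwa [Finset.sum_add_distrib, ← Finset.smul_sum, ← Finset.sum_smul, ← trace_sum, ← hB] at h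

/-- Sufficient separability criterion 1. -/
theorem stmt1 {N : ℕ} (hN : 1 ≤ N)
    (σ : Matrix (Fin 2 × Fin N) (Fin 2 × Fin N) ℂ) (hσ : σ.IsHermitian)
    (α : ℝ) (hα1 : -1 ≤ α) (hα2 : α ≤ 2) (hα0 : α ≠ 0)
    (hpos : (((α : ℂ))⁻¹ •
        (σ - (σ.trace / ((2 * (N : ℝ) + α : ℝ) : ℂ)) •
          (1 : Matrix (Fin 2 × Fin N) (Fin 2 × Fin N) ℂ))).PosSemidef) :
    IsSeparableMat σ := by
  have hα : (α : ℂ) ≠ 0 := by exact_mod_cast hα0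
  have hN' : (1 : ℝ) ≤ N := by exact_mod_cast hN
  have hd : ((2 * (N : ℝ) + α : ℝ) : ℂ) ≠ 0 := by
    have : 2 * (N : ℝ) + α ≠ 0 := by linarith
    exact_mod_cast this
  convert isSeparableMat_of_posSemidef hpos hα1 hα2 using 1
  have htr : ((α : ℂ)⁻¹ • (σ - (σ.trace / ((2 * (N : ℝ) + α : ℝ) : ℂ)) •
      (1 : Matrix (Fin 2 × Fin N) (Fin 2 × Fin N) ℂ))).trace =
      σ.trace / ((2 * (N : ℝ) + α : ℝ) : ℂ) := by
    simp only [trace_smul, trace_sub, trace_one, Fintype.card_prod, Fintype.card_fin, smul_eq_mul]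
    field_simp
    push_cast
    ring
  rw [htr, smul_smul, mul_inv_cancel₀ hα, one_smul, sub_add_cancel]
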